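/- arXiv:math/9205208 — 2 statements merged into one kernel-verified Lean document; each statement's English description precedes it below -/
import Mathlib

section
/- Let f, g : ℕ → ℕ with 1 ≤ g(k) < f(k) for all k. Then 𝔠(f·⌊f/g⌋, g) = 𝔠(f,g), where (f·⌊f/g⌋)(k) = f(k)·⌊f(k)/g(k)⌋ and ⌊·⌋ is the integer part. -/
/-- `B` is a `g`-slalom: a sequence of finite sets of naturals with `|B k| = g k`. -/
def IsSlalom (g : ℕ → ℕ) (B : ℕ → Finset ℕ) : Prop := ∀ k, (B k).card = g k

/-- `x` is covered by the slalom `B`. -/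
def Covers (B : ℕ → Finset ℕ) (x : ℕ → ℕ) : Prop := ∀ k, x k ∈ B k

/-- `slalomCov f g` is the least cardinality of a family of `g`-slaloms covering
every `x : ℕ → ℕ` with `x k < f k` for all `k`. -/
noncomputable def slalomCov (f g : ℕ → ℕ) : Cardinal :=
  sInf { c : Cardinal | ∃ 𝓑 : Set (ℕ → Finset ℕ),
    (∀ B ∈ 𝓑, IsSlalom g B) ∧
    (∀ x : ℕ → ℕ, (∀ k, x k < f k) → ∃ B ∈ 𝓑, Covers B x) ∧
    c = Cardinal.mk 𝓑 }

/-- `𝓑` is a family of `g`-slaloms covering every function bounded by `f`. -/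
def IsCoveringFamily (f g : ℕ → ℕ) (𝓑 : Set (ℕ → Finset ℕ)) : Prop :=
  (∀ B ∈ 𝓑, IsSlalom g B) ∧
    ∀ x : ℕ → ℕ, (∀ k, x k < f k) → ∃ B ∈ 𝓑, Covers B x

theorem slalomCov_le_mk {f g : ℕ → ℕ} {𝓑 : Set (ℕ → Finset ℕ)} (h : IsCoveringFamily f g 𝓑) :
    slalomCov f g ≤ Cardinal.mk 𝓑 :=
  csInf_le' ⟨𝓑, h.1, h.2, rfl⟩

theorem isCoveringFamily_setOf_isSlalom (f : ℕ → ℕ) {g : ℕ → ℕ} (hg : ∀ k, 1 ≤ g k) :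
    IsCoveringFamily f g {B | IsSlalom g B} := by
  refine ⟨fun B hB => hB, fun x _ => ?_⟩
  have h (k : ℕ) : ∃ t : Finset ℕ, {x k} ⊆ t ∧ t.card = g k :=
    Infinite.exists_superset_card_eq {x k} (g k) (by simpa using hg k)
  choose B hxB hB using h
  exact ⟨B, hB, fun k => Finset.singleton_subset_iff.1 (hxB k)⟩

theorem exists_isCoveringFamily_mk_eq (f : ℕ → ℕ) {g : ℕ → ℕ} (hg : ∀ k, 1 ≤ g k) :
    ∃ 𝓑, IsCoveringFamily f g 𝓑 ∧ slalomCov f g = Cardinal.mk 𝓑 := by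
  have hne : { c : Cardinal | ∃ 𝓑 : Set (ℕ → Finset ℕ), (∀ B ∈ 𝓑, IsSlalom g B) ∧
      (∀ x : ℕ → ℕ, (∀ k, x k < f k) → ∃ B ∈ 𝓑, Covers B x) ∧ c = Cardinal.mk 𝓑 }.Nonempty :=
    have h := isCoveringFamily_setOf_isSlalom f hg
    ⟨_, _, h.1, h.2, rfl⟩
  obtain ⟨𝓑, h₁, h₂, h₃⟩ := csInf_mem hne
  exact ⟨𝓑, ⟨h₁, h₂⟩, h₃⟩

theorem slalomCov_mono_left {f f' g : ℕ → ℕ} (hg : ∀ k, 1 ≤ g k) (hf : ∀ k, f k ≤ f' k) :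
    slalomCov f g ≤ slalomCov f' g := by
  obtain ⟨𝓑, h, hc⟩ := exists_isCoveringFamily_mk_eq f' hg
  rw [hc]
  exact slalomCov_le_mk ⟨h.1, fun x hx => h.2 x fun k => (hx k).trans_le (hf k)⟩

theorem IsCoveringFamily.infinite {f g : ℕ → ℕ} {𝓑 : Set (ℕ → Finset ℕ)}
    (h : IsCoveringFamily f g 𝓑) (hgf : ∀ k, g k < f k) : 𝓑.Infinite := by
  intro hfin
  have := hfin.to_subtype
  obtain ⟨i, hi⟩ := Countable.exists_injective_nat 𝓑
  have hx (k : ℕ) : ∃ n < f k, ∀ B : 𝓑, i B = k → n ∉ B.1 k := by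
    by_cases hk : ∃ B : 𝓑, i B = k
    · obtain ⟨B, rfl⟩ := hk
      obtain ⟨n, hn, hnB⟩ := Finset.exists_mem_notMem_of_card_lt_card
        (s := B.1 (i B)) (t := Finset.range (f (i B)))
        (by rw [h.1 B B.2, Finset.card_range]; exact hgf _)
      refine ⟨n, Finset.mem_range.1 hn, fun C hC => ?_⟩
      rwa [hi hC]
    · exact ⟨0, (Nat.zero_le _).trans_lt (hgf k), fun B hB => (hk ⟨B, hB⟩).elim⟩
  choose x hxf hxB using hx
  obtain ⟨B, hB, hBx⟩ := h.2 x hxf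
  exact hxB _ ⟨B, hB⟩ rfl (hBx _)

/-- Replaces the quotient of `n` by `m` by its rank in `S`, keeping the remainder. -/
def rankQuotient (S : Finset ℕ) (m n : ℕ) : ℕ := Nat.count (· ∈ S) (n / m) * m + n % m

theorem rankQuotient_lt {S : Finset ℕ} {m n : ℕ} (hm : 0 < m) (hn : n / m ∈ S) :
    rankQuotient S m n < S.card * m := by
  have h : Nat.count (· ∈ S) (n / m) < S.card := by
    simpa using Nat.count_lt_card (p := (· ∈ S)) S.finite_toSet hn
  have h₂ := Nat.mul_le_mul_right m (Nat.succ_le_of_lt h)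
  have h₃ := Nat.mod_lt n hm
  rw [Nat.succ_mul] at h₂
  unfold rankQuotient
  omega

theorem rankQuotient_inj {S : Finset ℕ} {m a b : ℕ} (hm : 0 < m) (ha : a / m ∈ S)
    (hb : b / m ∈ S) (h : rankQuotient S m a = rankQuotient S m b) : a = b := by
  unfold rankQuotient at h
  have hmod : a % m = b % m := by simpa using congrArg (· % m) h
  rw [hmod] at h
  have hdiv : a / m = b / m :=
    Nat.count_injective (p := (· ∈ S)) ha hb (Nat.eq_of_mul_eq_mul_right hm (by omega))
  rw [← Nat.div_add_mod a m, ← Nat.div_add_mod b m, hdiv, hmod]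

theorem exists_isSlalom_covers {m g : ℕ → ℕ} (hm : ∀ k, 0 < m k) (B : ℕ → Finset ℕ)
    {C : ℕ → Finset ℕ} (hC : IsSlalom g C) :
    ∃ D, IsSlalom g D ∧ ∀ x : ℕ → ℕ, Covers B (fun k => x k / m k) →
      Covers C (fun k => rankQuotient (B k) (m k) (x k)) → Covers D x := by
  have h (k : ℕ) : ∃ t : Finset ℕ, (∀ n, n / m k ∈ B k → rankQuotient (B k) (m k) n ∈ C k →
      n ∈ t) ∧ t.card = g k := by
    let s : Set ℕ := {n | n / m k ∈ B k ∧ rankQuotient (B k) (m k) n ∈ C k}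
    have hmaps : Set.MapsTo (rankQuotient (B k) (m k)) s (C k) := fun n hn => hn.2
    have hinj : Set.InjOn (rankQuotient (B k) (m k)) s :=
      fun a ha b hb hab => rankQuotient_inj (hm k) ha.1 hb.1 hab
    have hs : s.Finite := Set.Finite.of_injOn hmaps hinj (C k).finite_toSet
    have hcard : hs.toFinset.card ≤ g k := by
      rw [← hC k]
      exact Finset.card_le_card_of_injOn _ (by simpa using hmaps) (by simpa using hinj)
    obtain ⟨t, hst, ht⟩ := Infinite.exists_superset_card_eq hs.toFinset (g k) hcard
    exact ⟨t, fun n h₁ h₂ => hst (hs.mem_toFinset.2 ⟨h₁, h₂⟩), ht⟩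
  choose D hD hcard using h
  exact ⟨D, hcard, fun x h₁ h₂ k => hD k _ (h₁ k) (h₂ k)⟩

theorem slalomCov_mul_div_eq (f g : ℕ → ℕ) (hg : ∀ k, 1 ≤ g k) (hgf : ∀ k, g k < f k) :
    slalomCov (fun k => f k * (f k / g k)) g = slalomCov f g := by
  have hm (k : ℕ) : 0 < f k / g k := Nat.div_pos (hgf k).le (hg k)
  refine le_antisymm ?_ (slalomCov_mono_left hg fun k => Nat.le_mul_of_pos_right _ (hm k))
  obtain ⟨𝓑, h, hc⟩ := exists_isCoveringFamily_mk_eq f hg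
  have hinf : Infinite 𝓑 := (h.infinite hgf).to_subtype
  choose D hD hcov using fun p : 𝓑 × 𝓑 => exists_isSlalom_covers hm p.1.1 (h.1 p.2 p.2.2)
  have hfam : IsCoveringFamily (fun k => f k * (f k / g k)) g (Set.range D) := by
    refine ⟨by rintro _ ⟨p, rfl⟩; exact hD p, fun x hx => ?_⟩
    obtain ⟨B, hB, hBx⟩ := h.2 (fun k => x k / (f k / g k))
      fun k => (Nat.div_lt_iff_lt_mul (hm k)).2 (hx k)
    obtain ⟨C, hC, hCx⟩ := h.2 (fun k => rankQuotient (B k) (f k / g k) (x k)) fun k =>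
      (rankQuotient_lt (hm k) (hBx k)).trans_le (by rw [h.1 B hB k]; exact Nat.mul_div_le _ _)
    exact ⟨_, ⟨(⟨B, hB⟩, ⟨C, hC⟩), rfl⟩, hcov _ x hBx hCx⟩
  calc slalomCov (fun k => f k * (f k / g k)) g ≤ Cardinal.mk (Set.range D) := slalomCov_le_mk hfam
    _ ≤ Cardinal.mk (𝓑 × 𝓑) := Cardinal.mk_range_le
    _ = Cardinal.mk 𝓑 := by
      rw [Cardinal.mk_prod, Cardinal.lift_id, Cardinal.mul_eq_self (Cardinal.aleph0_le_mk _)]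
    _ = slalomCov f g := hc.symm
end

section
/- Let f, g : ℕ → ℕ with 1 ≤ g(k) < f(k) for all k. Then for every m ∈ ℕ, 𝔠(f + m(f−g), g) = 𝔠(f,g), where (f + m(f−g))(k) = f(k) + m·(f(k) − g(k)). -/
theorem slalomCov_le_mk_s18 {f g : ℕ → ℕ} {ι : Type} (B : ι → ℕ → Finset ℕ)
    (hB : ∀ i k, (B i k).card ≤ g k)
    (hcov : ∀ x : ℕ → ℕ, (∀ k, x k < f k) → ∃ i, Covers (B i) x) :
    slalomCov f g ≤ Cardinal.mk ι := by
  choose B' hsub hcard using fun i k => Infinite.exists_superset_card_eq (B i k) (g k) (hB i k)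
  refine le_trans (csInf_le' ⟨Set.range B', ?_, ?_, rfl⟩) Cardinal.mk_range_le
  · rintro _ ⟨i, rfl⟩
    exact hcard i
  · intro x hx
    obtain ⟨i, hi⟩ := hcov x hx
    exact ⟨B' i, ⟨i, rfl⟩, fun k => hsub i k (hi k)⟩

theorem exists_mk_eq_slalomCov (f : ℕ → ℕ) {g : ℕ → ℕ} (hg : ∀ k, 1 ≤ g k) :
    ∃ 𝓑 : Set (ℕ → Finset ℕ), (∀ B ∈ 𝓑, IsSlalom g B) ∧
      (∀ x : ℕ → ℕ, (∀ k, x k < f k) → ∃ B ∈ 𝓑, Covers B x) ∧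
      slalomCov f g = Cardinal.mk 𝓑 := by
  refine csInf_mem (s := { c : Cardinal | ∃ 𝓑 : Set (ℕ → Finset ℕ),
    (∀ B ∈ 𝓑, IsSlalom g B) ∧
    (∀ x : ℕ → ℕ, (∀ k, x k < f k) → ∃ B ∈ 𝓑, Covers B x) ∧
    c = Cardinal.mk 𝓑 }) ⟨_, {B | IsSlalom g B}, fun _ h => h, fun x _ => ?_, rfl⟩
  choose B hsub hcard using fun k =>
    Infinite.exists_superset_card_eq ({x k} : Finset ℕ) (g k) (by simpa using hg k)
  exact ⟨B, hcard, fun k => hsub k (Finset.mem_singleton_self _)⟩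

/-- Countably many slaloms are defeated by diagonalization. -/
theorem aleph0_le_slalomCov {f g : ℕ → ℕ} (hg : ∀ k, 1 ≤ g k) (hgf : ∀ k, g k < f k) :
    Cardinal.aleph0 ≤ slalomCov f g := by
  obtain ⟨𝓑, hs, hc, h⟩ := exists_mk_eq_slalomCov f hg
  rw [h]
  by_contra! hlt
  have : Countable 𝓑 := Cardinal.mk_le_aleph0_iff.1 hlt.le
  have : Nonempty 𝓑 := by
    obtain ⟨B, hB, -⟩ := hc (fun _ => 0) fun k => (Nat.zero_le _).trans_lt (hgf k)
    exact ⟨⟨B, hB⟩⟩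
  obtain ⟨s, hsurj⟩ := exists_surjective_nat 𝓑
  have hmiss : ∀ k, ∃ y ∈ Finset.range (f k), y ∉ (s k).1 k := fun k =>
    Finset.exists_mem_notMem_of_card_lt_card (by
      rw [hs _ (s k).2 k, Finset.card_range]
      exact hgf k)
  choose x hxf hx using hmiss
  obtain ⟨B, hB, hcov⟩ := hc x fun k => Finset.mem_range.1 (hxf k)
  obtain ⟨k, hk⟩ := hsurj ⟨B, hB⟩
  apply hx k
  rw [hk]
  exact hcov k

theorem slalomCov_add_add_le {f g : ℕ → ℕ} (hg : ∀ k, 1 ≤ g k) (hf : ∀ k, 0 < f k)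
    (d : ℕ → ℕ) :
    slalomCov (fun k => f k + d k) (fun k => g k + d k) ≤ slalomCov f g := by
  obtain ⟨𝓑, hs, hc, h⟩ := exists_mk_eq_slalomCov f hg
  rw [h]
  refine slalomCov_le_mk_s18 (fun B : 𝓑 => fun k => B.1 k ∪ Finset.Ico (f k) (f k + d k)) ?_ ?_
  · intro B k
    refine (Finset.card_union_le _ _).trans ?_
    rw [hs _ B.2 k, Nat.card_Ico]
    omega
  · intro x hx
    obtain ⟨B, hB, hcov⟩ := hc (fun k => if x k < f k then x k else 0) fun k => by
      split_ifs with hk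
      exacts [hk, hf k]
    refine ⟨⟨B, hB⟩, fun k => ?_⟩
    have hk : (if x k < f k then x k else 0) ∈ B k := hcov k
    by_cases hxf : x k < f k
    · rw [if_pos hxf] at hk
      exact Finset.mem_union_left _ hk
    · exact Finset.mem_union_right _ (Finset.mem_Ico.2 ⟨not_lt.1 hxf, hx k⟩)

theorem slalomCov_le_mul {g h : ℕ → ℕ} (f : ℕ → ℕ) (hg : ∀ k, 1 ≤ g k) (hh : ∀ k, 1 ≤ h k) :
    slalomCov f g ≤ slalomCov f h * slalomCov h g := by
  obtain ⟨𝓐, hsA, hcA, hA⟩ := exists_mk_eq_slalomCov f hh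
  obtain ⟨𝓑, hsB, hcB, hB⟩ := exists_mk_eq_slalomCov h hg
  rw [hA, hB, Cardinal.mul_def]
  refine slalomCov_le_mk_s18
    (fun p : 𝓐 × 𝓑 => fun k => (p.2.1 k).image fun i => (p.1.1 k).toList.getD i 0) ?_ ?_
  · intro p k
    exact Finset.card_image_le.trans (hsB _ p.2.2 k).le
  · intro x hx
    obtain ⟨A, hAm, hAx⟩ := hcA x hx
    have hidx : ∀ k, ∃ i < h k, (A k).toList.getD i 0 = x k := fun k => by
      obtain ⟨i, hi, hix⟩ := List.mem_iff_getElem.1 (Finset.mem_toList.2 (hAx k))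
      refine ⟨i, ?_, ?_⟩
      · rwa [Finset.length_toList, hsA A hAm k] at hi
      · rw [List.getD_eq_getElem _ _ hi, hix]
    choose y hyh hy using hidx
    obtain ⟨B, hBm, hBy⟩ := hcB y hyh
    exact ⟨(⟨A, hAm⟩, ⟨B, hBm⟩), fun k => Finset.mem_image.2 ⟨y k, hBy k, hy k⟩⟩

theorem slalomCov_add_mul_sub_eq (f g : ℕ → ℕ) (hg : ∀ k, 1 ≤ g k) (hgf : ∀ k, g k < f k)
    (m : ℕ) :
    slalomCov (fun k => f k + m * (f k - g k)) g = slalomCov f g := by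
  refine le_antisymm ?_ (slalomCov_mono_left hg fun k => Nat.le_add_right _ _)
  induction m with
  | zero => simp
  | succ m ih =>
    have hf : ∀ k, 0 < f k := fun k => (Nat.zero_le _).trans_lt (hgf k)
    have hstep : slalomCov (fun k => f k + (m + 1) * (f k - g k))
        (fun k => f k + m * (f k - g k)) ≤ slalomCov f g := by
      convert slalomCov_add_add_le hg hf (fun k => (m + 1) * (f k - g k)) using 3 with k
      have := hgf k
      rw [Nat.succ_mul]
      omega
    calc _ ≤ _ := slalomCov_le_mul _ hg fun k => (hf k).trans_le (Nat.le_add_right _ _)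
      _ ≤ slalomCov f g * slalomCov f g := mul_le_mul' hstep ih
      _ = slalomCov f g := Cardinal.mul_eq_self (aleph0_le_slalomCov hg hgf)
end
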